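/- Let g ≥ 1. Suppose b, b' ∈ GL_2(K)^g satisfy μ(((b∗σ)^i)_j) = μ(((b'∗σ)^i)_j) for all i = 1,…,2g and all j ∈ ℤ/gℤ. Suppose moreover that B := ((b∗σ)^g)_0 and B' := ((b'∗σ)^g)_0 can be written B = c·R·σ^g(c)⁻¹ and B' = c'·R'·σ^g(c')⁻¹ with c, c' ∈ GL_2(K) and R, R' normal forms. Then R and R' have the same multiset of Newton slopes. (Equivalently, the first 2g Hodge points of the σ-twisted powers of an element of Res_{F/ℚ_p}(GL_2), F/ℚ_p unramified of degree g, determine its Newton point.) -/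

import Mathlib

/-!
Statement 14.  For `g ≥ 1` and `b = (b_0,…,b_{g−1}) ∈ GL_2(K)^g`, the `i`-th
component of the `k`-th `σ`-twisted power of `b` in `Res_{F/ℚ_p}(GL_2)(K)` is
`((b∗σ)^k)_i = b_i·σ(b_{i−1})···σ^{k−1}(b_{i−k+1})` (indices mod `g`).

If all Hodge points `μ(((b∗σ)^i)_j)` for `i = 1,…,2g`, `j ∈ ℤ/gℤ` agree with
those of `b'`, and `B = ((b∗σ)^g)_0 = c·R·σ^g(c)⁻¹`,
`B' = ((b'∗σ)^g)_0 = c'·R'·σ^g(c')⁻¹` with `R, R'` normal forms, then `R` and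
`R'` have the same multiset of Newton slopes.
-/

open Matrix

noncomputable section

variable (p : ℕ) [Fact p.Prime] (κ : Type) [Field κ] [IsAlgClosed κ] [CharP κ p]

local notation "𝕎" => WittVector p κ
local notation "K" => FractionRing (WittVector p κ)

/-- `c ∈ GL_n(W(κ)) ⊆ GL_n(K)`. -/
def IsIntegralUnit {n : ℕ} (c : Matrix (Fin n) (Fin n) K) : Prop :=
  ∃ d : Matrix (Fin n) (Fin n) 𝕎, IsUnit d.det ∧ c = d.map (algebraMap 𝕎 K)

/-- `μ` is the Hodge point of `b`. -/
def IsHodgePoint {n : ℕ} (b : Matrix (Fin n) (Fin n) K) (μ : Fin n → ℤ) : Prop :=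
  Antitone μ ∧ ∃ c₁ c₂ : Matrix (Fin n) (Fin n) K, IsIntegralUnit p κ c₁ ∧ IsIntegralUnit p κ c₂ ∧
    b = c₁ * Matrix.diagonal (fun i => (p : K) ^ (μ i)) * c₂

/-- `starPow σ b k i = ((b∗σ)^k)_i = b_i·σ(b_{i−1})···σ^{k−1}(b_{i−k+1})`. -/
def starPow {g : ℕ} (σ : K ≃+* K) (b : ZMod g → Matrix (Fin 2) (Fin 2) K) :
    ℕ → ZMod g → Matrix (Fin 2) (Fin 2) K
  | 0, _ => 1
  | (k + 1), i => b i * (starPow σ b k (i - 1)).map ⇑σ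

/-- `R` is a normal form (over `K`, with uniformizer `p`) with multiset of
Newton slopes `slo`. -/
def IsNormalFormWithSlopes (R : Matrix (Fin 2) (Fin 2) K) (slo : Multiset ℚ) : Prop :=
  (∃ a b : ℤ, a ≤ b ∧ R = Matrix.diagonal ![(p : K) ^ a, (p : K) ^ b] ∧
    slo = {(a : ℚ), (b : ℚ)}) ∨
  (∃ h : ℤ, Odd h ∧ R = !![0, (p : K) ^ h; 1, 0] ∧ slo = {(h : ℚ) / 2, (h : ℚ) / 2})

theorem gen_diag {L Γ : Type*} [Field L] [LinearOrderedCommGroupWithZero Γ] (v : Valuation L Γ)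
    (τ : L →+* L) (hτ : ∀ x, v (τ x) = v x) (P Q : L) (hPQ : v Q < v P) (x y z w : L)
    (hx : x ≠ 0 ∨ z ≠ 0) (hy : y ≠ 0 ∨ w ≠ 0) (N : Γ) :
    (v (P * x * τ w - Q * y * τ z) ≤ N ∧ v (Q * y * τ x - P * x * τ y) ≤ N ∧
     v (P * z * τ w - Q * w * τ z) ≤ N ∧ v (Q * w * τ x - P * z * τ y) ≤ N) ↔
    v P * (max (v x) (v z)) * (max (v y) (v w)) ≤ N := by
  set X := max (v x) (v z) with hX
  set Y := max (v y) (v w) with hY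
  have hX0 : 0 < X := by
    rcases hx with h | h
    · exact lt_of_lt_of_le (zero_lt_iff.2 ((v.ne_zero_iff).2 h)) (le_max_left _ _)
    · exact lt_of_lt_of_le (zero_lt_iff.2 ((v.ne_zero_iff).2 h)) (le_max_right _ _)
  have hY0 : 0 < Y := by
    rcases hy with h | h
    · exact lt_of_lt_of_le (zero_lt_iff.2 ((v.ne_zero_iff).2 h)) (le_max_left _ _)
    · exact lt_of_lt_of_le (zero_lt_iff.2 ((v.ne_zero_iff).2 h)) (le_max_right _ _)
  have xX : v x ≤ X := le_max_left _ _
  have zX : v z ≤ X := le_max_right _ _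
  have yY : v y ≤ Y := le_max_left _ _
  have wY : v w ≤ Y := le_max_right _ _
  have key1 : ∀ s t, v s ≤ X → v t ≤ Y → v (P * s * τ t) ≤ v P * X * Y := by
    intro s t hs ht
    rw [map_mul, map_mul, hτ]; gcongr
  have key2 : ∀ s t, v s ≤ X → v t ≤ Y → v (Q * t * τ s) < v P * X * Y := by
    intro s t hs ht
    rw [map_mul, map_mul, hτ]
    calc v Q * v t * v s ≤ v Q * Y * X := by gcongr
      _ = v Q * (X * Y) := by rw [mul_assoc, mul_comm Y]
      _ < v P * (X * Y) := mul_lt_mul_of_pos_right hPQ (mul_pos hX0 hY0)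
      _ = _ := by rw [mul_assoc]
  have key3 : ∀ s t s' t', v s = X → v t = Y → v s' ≤ X → v t' ≤ Y →
      v (P * s * τ t - Q * t' * τ s') = v P * X * Y := by
    intro s t s' t' hs ht hs' ht'
    have e : v (P * s * τ t) = v P * X * Y := by rw [map_mul, map_mul, hτ, hs, ht]
    rw [Valuation.map_sub_eq_of_lt_left, e]
    rw [e]; exact key2 _ _ hs' ht'
  constructor
  · rintro ⟨h1, h2, h3, h4⟩
    rw [v.map_sub_swap] at h2 h4
    rcases max_choice (v x) (v z) with e | e <;> rcases max_choice (v y) (v w) with f | f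
    · rw [← key3 x y x y e.symm f.symm xX yY]; exact h2
    · rw [← key3 x w z y e.symm f.symm zX yY]; exact h1
    · rw [← key3 z y x w e.symm f.symm xX wY]; exact h4
    · rw [← key3 z w z w e.symm f.symm zX wY]; exact h3
  · intro h
    rw [v.map_sub_swap (Q * y * τ x), v.map_sub_swap (Q * w * τ x)]
    refine ⟨?_, ?_, ?_, ?_⟩ <;> refine (v.map_sub_le ?_ ?_).trans h
    all_goals first | exact key1 _ _ (by assumption) (by assumption) | exact (key2 _ _ (by assumption) (by assumption)).le

theorem gen_eq_off {L Γ : Type*} [Field L] [LinearOrderedCommGroupWithZero Γ] (v : Valuation L Γ)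
    (τ : L →+* L) (hτ : ∀ x, v (τ x) = v x) (x y : L) (N : Γ)
    (h : v (y * τ x - x * τ y) ≤ N) : v (y * τ (τ x) - x * τ (τ y)) ≤ N := by
  by_cases hx : x = 0
  · subst hx; simp
  have h1 : τ x ≠ 0 := by simpa using hx
  have h2 : τ (τ x) ≠ 0 := by simpa using hx
  have e : y * τ (τ x) - x * τ (τ y) =
      (y * τ x - x * τ y) * (τ (τ x) / τ x) + τ (y * τ x - x * τ y) * (x / τ x) := by
    simp only [map_sub, map_mul]; field_simp; ring
  have v0 : v x ≠ 0 := v.ne_zero_iff.2 hx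
  rw [e]
  refine v.map_add_le ?_ ?_
  · rw [map_mul, map_div₀, hτ, hτ, div_self v0, mul_one]; exact h
  · rw [map_mul, map_div₀, hτ, hτ, div_self v0, mul_one]; exact h

theorem gen_eq_aux {L Γ : Type*} [Field L] [LinearOrderedCommGroupWithZero Γ] (v : Valuation L Γ)
    (τ : L →+* L) (hτ : ∀ x, v (τ x) = v x) (x y z w : L) (N : Γ) (hx : x ≠ 0) (hxz : v z ≤ v x)
    (h1 : v (x * τ w - y * τ z) ≤ N) (h2 : v (y * τ x - x * τ y) ≤ N) :
    v (x * τ (τ w) - y * τ (τ z)) ≤ N ∧ v (w * τ (τ x) - z * τ (τ y)) ≤ N := by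
  have v0 : v x ≠ 0 := v.ne_zero_iff.2 hx
  have k1 : τ x ≠ 0 := by simpa using hx
  have k2 : τ (τ x) ≠ 0 := by simpa using hx
  have h2' := gen_eq_off v τ hτ x y N h2
  have ht : v z / v x ≤ 1 := div_le_one_of_le₀ hxz zero_le
  have hN : ∀ s, v s ≤ N → (v z / v x) * v s ≤ N := fun s hs =>
    (mul_le_of_le_one_left zero_le ht).trans hs
  have hD : v (x * w - y * z) ≤ N := by
    have e : τ (x * w - y * z) * (x / τ x) =
        (x * τ w - y * τ z) + (τ z / τ x) * (y * τ x - x * τ y) := by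
      simp only [map_sub, map_mul]; field_simp; ring
    have : v (τ (x * w - y * z) * (x / τ x)) ≤ N := by
      rw [e]
      refine v.map_add_le h1 ?_
      rw [map_mul, map_div₀, hτ, hτ]; exact hN _ h2
    rwa [map_mul, map_div₀, hτ, hτ, div_self v0, mul_one] at this
  constructor
  · have e : x * τ (τ w) - y * τ (τ z) = τ (τ (x * w - y * z)) * (x / τ (τ x)) -
        (τ (τ z) / τ (τ x)) * (y * τ (τ x) - x * τ (τ y)) := by
      simp only [map_sub, map_mul]; field_simp; ring
    rw [e]
    refine v.map_sub_le ?_ ?_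
    · rw [map_mul, map_div₀, hτ, hτ, hτ, hτ, div_self v0, mul_one]; exact hD
    · rw [map_mul, map_div₀, hτ, hτ, hτ, hτ]; exact hN _ h2'
  · have e : w * τ (τ x) - z * τ (τ y) = (x * w - y * z) * (τ (τ x) / x) +
        (z / x) * (y * τ (τ x) - x * τ (τ y)) := by
      field_simp; ring
    rw [e]
    refine v.map_add_le ?_ ?_
    · rw [map_mul, map_div₀, hτ, hτ, div_self v0, mul_one]; exact hD
    · rw [map_mul, map_div₀]; exact hN _ h2'

theorem gen_eq {L Γ : Type*} [Field L] [LinearOrderedCommGroupWithZero Γ] (v : Valuation L Γ)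
    (τ : L →+* L) (hτ : ∀ x, v (τ x) = v x) (x y z w : L) (N : Γ) (hx : x ≠ 0 ∨ z ≠ 0)
    (h1 : v (x * τ w - y * τ z) ≤ N) (h2 : v (y * τ x - x * τ y) ≤ N)
    (h3 : v (z * τ w - w * τ z) ≤ N) (h4 : v (w * τ x - z * τ y) ≤ N) :
    v (x * τ (τ w) - y * τ (τ z)) ≤ N ∧ v (y * τ (τ x) - x * τ (τ y)) ≤ N ∧
    v (z * τ (τ w) - w * τ (τ z)) ≤ N ∧ v (w * τ (τ x) - z * τ (τ y)) ≤ N := by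
  have a := gen_eq_off v τ hτ x y N h2
  have b := gen_eq_off v τ hτ w z N h3
  rcases le_total (v z) (v x) with h | h
  · have x0 : x ≠ 0 := by
      rintro rfl
      rcases hx with hx | hx
      · exact hx rfl
      · rw [map_zero] at h; exact hx (v.zero_iff.1 (le_antisymm h zero_le))
    obtain ⟨c, d⟩ := gen_eq_aux v τ hτ x y z w N x0 h h1 h2
    exact ⟨c, a, b, d⟩
  · have z0 : z ≠ 0 := by
      rintro rfl
      rcases hx with hx | hx
      · rw [map_zero] at h; exact hx (v.zero_iff.1 (le_antisymm h zero_le))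
      · exact hx rfl
    obtain ⟨c, d⟩ := gen_eq_aux v τ hτ z w x y N z0 h (by rwa [v.map_sub_swap]) (by rwa [v.map_sub_swap])
    exact ⟨by rwa [v.map_sub_swap], a, b, by rwa [v.map_sub_swap]⟩

theorem gen_odd_aux {L Γ : Type*} [Field L] [LinearOrderedCommGroupWithZero Γ] (v : Valuation L Γ)
    (τ : L →+* L) (hτ : ∀ x, v (τ x) = v x) (Q : L)
    (hQ : ∀ s t, s ≠ 0 → v s * v s ≠ v Q * v t * v t) (s t : L) (N : Γ)
    (h : v (s * τ s - Q * t * τ t) ≤ N) : v s * v s ≤ N ∧ v Q * v t * v t ≤ N := by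
  by_cases hs : s = 0
  · subst hs
    have : v (Q * t * τ t) ≤ N := by simpa using h
    rw [map_mul, map_mul, hτ] at this
    refine ⟨?_, this⟩
    simp
  · have hne := hQ s t hs
    have e1 : v (s * τ s) = v s * v s := by rw [map_mul, hτ]
    have e2 : v (Q * t * τ t) = v Q * v t * v t := by rw [map_mul, map_mul, hτ]
    rw [← e1, ← e2] at hne ⊢
    rcases lt_or_gt_of_ne hne with hl | hl
    · rw [Valuation.map_sub_eq_of_lt_right _ hl] at h
      exact ⟨hl.le.trans h, h⟩
    · rw [Valuation.map_sub_eq_of_lt_left _ hl] at h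
      exact ⟨h, hl.le.trans h⟩

theorem ent_diag {L : Type*} [Field L] (τ : L →+* L) (x y z w P Q : L) :
    !![x, y; z, w] * Matrix.diagonal ![P, Q] * ((!![x, y; z, w]).map τ)⁻¹ =
    (τ (x * w - y * z))⁻¹ • !![P * x * τ w - Q * y * τ z, Q * y * τ x - P * x * τ y;
      P * z * τ w - Q * w * τ z, Q * w * τ x - P * z * τ y] := by
  have hdg : Matrix.diagonal ![P, Q] = !![P, 0; 0, Q] := by
    ext i j; fin_cases i <;> fin_cases j <;> simp
  rw [hdg, Matrix.inv_def, Matrix.mul_smul, Matrix.adjugate_fin_two, Matrix.det_fin_two]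
  congr 1
  · simp
  · ext i j
    fin_cases i <;> fin_cases j <;> simp [Matrix.mul_apply, Fin.sum_univ_two] <;> ring

theorem ent_odd {L : Type*} [Field L] (τ : L →+* L) (x y z w Q : L) :
    !![x, y; z, w] * !![0, Q; 1, 0] * ((!![x, y; z, w]).map τ)⁻¹ =
    (τ (x * w - y * z))⁻¹ • !![y * τ w - Q * x * τ z, Q * x * τ x - y * τ y;
      w * τ w - Q * z * τ z, Q * z * τ x - w * τ y] := by
  rw [Matrix.inv_def, Matrix.mul_smul, Matrix.adjugate_fin_two, Matrix.det_fin_two]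
  congr 1
  · simp
  · ext i j
    fin_cases i <;> fin_cases j <;> simp [Matrix.mul_apply, Fin.sum_univ_two] <;> ring

theorem good_smul {L Γ : Type*} [Field L] [LinearOrderedCommGroupWithZero Γ] (v : Valuation L Γ)
    (D : L) (hD : D ≠ 0) (a b c d : L) (N : Γ) :
    (∀ i j, v ((D⁻¹ • !![a, b; c, d]) i j) ≤ N) ↔
      (v a ≤ N * v D ∧ v b ≤ N * v D ∧ v c ≤ N * v D ∧ v d ≤ N * v D) := by
  have v0 : 0 < v D := zero_lt_iff.2 (v.ne_zero_iff.2 hD)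
  have : ∀ x, v (D⁻¹ * x) ≤ N ↔ v x ≤ N * v D := by
    intro x
    rw [map_mul, map_inv₀, mul_comm, ← div_eq_mul_inv, div_le_iff₀ v0]
  simp [Fin.forall_fin_two, ← this, and_assoc]

theorem mat_two {L : Type*} [Field L] (τ : L →+* L) (c R : Matrix (Fin 2) (Fin 2) L)
    (hc : IsUnit c.det) (hR : R.map τ = R) :
    (c * R * (c.map τ)⁻¹) * (c * R * (c.map τ)⁻¹).map τ =
      c * (R * R) * (c.map (τ.comp τ))⁻¹ := by
  have hinv : ((c.map τ)⁻¹).map τ = ((c.map τ).map τ)⁻¹ := by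
    have h : IsUnit (c.map τ).det := by
      rw [← RingHom.mapMatrix_apply, ← RingHom.map_det]; exact hc.map τ
    symm
    apply Matrix.inv_eq_left_inv
    rw [← Matrix.map_mul, Matrix.nonsing_inv_mul _ h]
    simp
  have h : IsUnit (c.map τ).det := by
    rw [← RingHom.mapMatrix_apply, ← RingHom.map_det]; exact hc.map τ
  rw [Matrix.map_mul, Matrix.map_mul, hR, hinv, Matrix.map_map]
  have e : c.map (⇑τ ∘ ⇑τ) = c.map (τ.comp τ) := by simp
  rw [e]
  simp only [Matrix.mul_assoc]
  rw [Matrix.nonsing_inv_mul_cancel_left _ _ h]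

theorem det_val {L Γ : Type*} [Field L] [LinearOrderedCommGroupWithZero Γ] (v : Valuation L Γ)
    (τ : L →+* L) (hτ : ∀ x, v (τ x) = v x) (c R : Matrix (Fin 2) (Fin 2) L)
    (hc : IsUnit c.det) : v (c * R * (c.map τ)⁻¹).det = v R.det := by
  have : v c.det ≠ 0 := v.ne_zero_iff.2 hc.ne_zero
  rw [Matrix.det_mul, Matrix.det_mul, Matrix.det_nonsing_inv, ← RingHom.mapMatrix_apply,
    ← RingHom.map_det, Ring.inverse_eq_inv', map_mul, map_mul, map_inv₀, hτ]
  field_simp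

theorem slopes_diag {L Γ : Type*} [Field L] [LinearOrderedCommGroupWithZero Γ] (v : Valuation L Γ)
    (τ : L →+* L) (hτ : ∀ x, v (τ x) = v x) (ϖ : L) (hϖ : τ ϖ = ϖ) (h0 : ϖ ≠ 0) (h1 : v ϖ < 1)
    (hgen : ∀ x, x ≠ 0 → ∃ n : ℤ, v x = v ϖ ^ n)
    (c : Matrix (Fin 2) (Fin 2) L) (hc : IsUnit c.det) (a b : ℤ) (hab : a ≤ b) (m1 m2 s : ℤ)
    (B : Matrix (Fin 2) (Fin 2) L)
    (hB : B = c * Matrix.diagonal ![ϖ ^ a, ϖ ^ b] * (c.map τ)⁻¹)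
    (hm1 : ∀ n : ℤ, (∀ i j, v (B i j) ≤ v ϖ ^ n) ↔ n ≤ m1)
    (hm2 : ∀ n : ℤ, (∀ i j, v ((B * B.map τ) i j) ≤ v ϖ ^ n) ↔ n ≤ m2)
    (hs : v B.det = v ϖ ^ s) : s = a + b ∧ 2 * a = min (2 * (m2 - m1)) s := by
  have hp0 : 0 < v ϖ := zero_lt_iff.2 (v.ne_zero_iff.2 h0)
  have hle : ∀ m n : ℤ, v ϖ ^ m ≤ v ϖ ^ n ↔ n ≤ m := fun m n => zpow_le_zpow_iff_right_of_lt_one₀ hp0 h1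
  have hadd : ∀ m n : ℤ, v ϖ ^ m * v ϖ ^ n = v ϖ ^ (m + n) := fun m n => (zpow_add₀ hp0.ne' m n).symm
  have hs' : s = a + b := by
    rw [hB, det_val v τ hτ c _ hc, Matrix.det_diagonal] at hs
    simp only [Fin.prod_univ_two, Matrix.cons_val_zero, Matrix.cons_val_one, map_mul, map_zpow₀,
      hadd] at hs
    exact le_antisymm ((hle _ _).1 hs.le) ((hle _ _).1 hs.ge)
  refine ⟨hs', ?_⟩
  have hB2 := mat_two τ c (Matrix.diagonal ![ϖ ^ a, ϖ ^ b]) hc (by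
    ext i j; fin_cases i <;> fin_cases j <;> simp [hϖ])
  rw [← hB] at hB2
  have hRR : Matrix.diagonal ![ϖ ^ a, ϖ ^ b] * Matrix.diagonal ![ϖ ^ a, ϖ ^ b] =
      Matrix.diagonal ![ϖ ^ (a + a), ϖ ^ (b + b)] := by
    ext i j; fin_cases i <;> fin_cases j <;> simp [zpow_add₀ h0]
  rw [hRR] at hB2
  obtain ⟨x, y, z, w, rfl⟩ : ∃ x y z w, c = !![x, y; z, w] :=
    ⟨_, _, _, _, Matrix.eta_fin_two c⟩
  have hD : x * w - y * z ≠ 0 := by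
    have := hc.ne_zero
    rwa [Matrix.det_fin_two_of] at this
  have hx : x ≠ 0 ∨ z ≠ 0 := by
    by_contra! h; apply hD; simp [h.1, h.2]
  have hy : y ≠ 0 ∨ w ≠ 0 := by
    by_contra! h; apply hD; simp [h.1, h.2]
  rw [ent_diag] at hB hB2
  obtain ⟨d, hd⟩ := hgen _ hD
  have hτ2 : ∀ x, v ((τ.comp τ) x) = v x := fun x => by simp [hτ]
  have g1 : ∀ n, _ := fun n : ℤ => good_smul v (τ (x * w - y * z)) ((map_ne_zero _).2 hD) (ϖ ^ a * x * τ w - ϖ ^ b * y * τ z)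
     (ϖ ^ b * y * τ x - ϖ ^ a * x * τ y)
      (ϖ ^ a * z * τ w - ϖ ^ b * w * τ z) (ϖ ^ b * w * τ x - ϖ ^ a * z * τ y) (v ϖ ^ n)
  have g2 : ∀ n, _ := fun n : ℤ => good_smul v ((τ.comp τ) (x * w - y * z)) ((map_ne_zero _).2 hD)
     (ϖ ^ (a+a) * x * (τ.comp τ) w - ϖ ^ (b+b) * y * (τ.comp τ) z)
     (ϖ ^ (b+b) * y * (τ.comp τ) x - ϖ ^ (a+a) * x * (τ.comp τ) y)
      (ϖ ^ (a+a) * z * (τ.comp τ) w - ϖ ^ (b+b) * w * (τ.comp τ) z)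
      (ϖ ^ (b+b) * w * (τ.comp τ) x - ϖ ^ (a+a) * z * (τ.comp τ) y) (v ϖ ^ n)
  rw [← hB] at g1
  rw [← hB2] at g2
  simp only [hm1, hm2, hτ, hτ2, hd, hadd] at g1 g2
  rcases hab.lt_or_eq with hlt | rfl
  · have k1 : ∀ n, _ := fun n : ℤ => gen_diag v τ hτ (ϖ ^ a) (ϖ ^ b) (by
      rw [map_zpow₀, map_zpow₀]; exact zpow_lt_zpow_right_of_lt_one₀ hp0 h1 hlt) x y z w hx hy (v ϖ ^ (n + d))
    have k2 : ∀ n, _ := fun n : ℤ => gen_diag v (τ.comp τ) hτ2 (ϖ ^ (a+a)) (ϖ ^ (b+b)) (by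
      rw [map_zpow₀, map_zpow₀]; exact zpow_lt_zpow_right_of_lt_one₀ hp0 h1 (by omega)) x y z w hx hy (v ϖ ^ (n + d))
    obtain ⟨i, hi⟩ : ∃ i : ℤ, max (v x) (v z) = v ϖ ^ i := by
      rcases hx with h | h <;> rcases max_choice (v x) (v z) with e | e
      · rw [e]; exact hgen _ h
      · rw [e]; refine hgen _ ?_
        rintro rfl; rw [map_zero] at e; exact h (v.zero_iff.1 (by simpa using e))
      · rw [e]; refine hgen _ ?_
        rintro rfl; rw [map_zero] at e; exact h (v.zero_iff.1 (by simpa using e))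
      · rw [e]; exact hgen _ h
    obtain ⟨j, hj⟩ : ∃ i : ℤ, max (v y) (v w) = v ϖ ^ i := by
      rcases hy with h | h <;> rcases max_choice (v y) (v w) with e | e
      · rw [e]; exact hgen _ h
      · rw [e]; refine hgen _ ?_
        rintro rfl; rw [map_zero] at e; exact h (v.zero_iff.1 (by simpa using e))
      · rw [e]; refine hgen _ ?_
        rintro rfl; rw [map_zero] at e; exact h (v.zero_iff.1 (by simpa using e))
      · rw [e]; exact hgen _ h
    simp only [← g1, ← g2, hi, hj, map_zpow₀, hadd, hle] at k1 k2
    have e1 : m1 = a + i + j - d := by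
      have := k1 m1; have := k1 (a + i + j - d); omega
    have e2 : m2 = a + a + i + j - d := by
      have := k2 m2; have := k2 (a + a + i + j - d); omega
    omega
  · have e1 := (g1 m1).1 le_rfl
    simp only [mul_assoc, ← mul_sub, map_mul, map_zpow₀] at e1
    have hq : 0 < v ϖ ^ a := zpow_pos hp0 a
    have conv : ∀ (k : ℤ) (u : L) (n : ℤ), v ϖ ^ k * v u ≤ v ϖ ^ n ↔ v u ≤ v ϖ ^ (n - k) := by
      intro k u n
      rw [← mul_le_mul_iff_of_pos_left (zpow_pos hp0 k) (b := v u), hadd]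
      congr! 2; ring
    simp only [conv] at e1
    obtain ⟨q1, q2, q3, q4⟩ := e1
    have e2 := gen_eq v τ hτ x y z w _ hx q1 q2 q3 q4
    have := (g2 (m1 + a)).2 (by
      simp only [mul_assoc, ← mul_sub, map_mul, map_zpow₀, conv]
      rw [show m1 + a + d - (a + a) = m1 + d - a by ring]
      exact e2)
    omega

theorem slopes_odd {L Γ : Type*} [Field L] [LinearOrderedCommGroupWithZero Γ] (v : Valuation L Γ)
    (τ : L →+* L) (hτ : ∀ x, v (τ x) = v x) (ϖ : L) (hϖ : τ ϖ = ϖ) (h0 : ϖ ≠ 0) (h1 : v ϖ < 1)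
    (hgen : ∀ x, x ≠ 0 → ∃ n : ℤ, v x = v ϖ ^ n)
    (c : Matrix (Fin 2) (Fin 2) L) (hc : IsUnit c.det) (h : ℤ) (hodd : Odd h) (m1 m2 s : ℤ)
    (B : Matrix (Fin 2) (Fin 2) L)
    (hB : B = c * !![0, ϖ ^ h; 1, 0] * (c.map τ)⁻¹)
    (hm1 : ∀ n : ℤ, (∀ i j, v (B i j) ≤ v ϖ ^ n) ↔ n ≤ m1)
    (hm2 : ∀ n : ℤ, (∀ i j, v ((B * B.map τ) i j) ≤ v ϖ ^ n) ↔ n ≤ m2)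
    (hs : v B.det = v ϖ ^ s) : s = h ∧ h = min (2 * (m2 - m1)) s := by
  have hp0 : 0 < v ϖ := zero_lt_iff.2 (v.ne_zero_iff.2 h0)
  have hle : ∀ m n : ℤ, v ϖ ^ m ≤ v ϖ ^ n ↔ n ≤ m := fun m n => zpow_le_zpow_iff_right_of_lt_one₀ hp0 h1
  have hadd : ∀ m n : ℤ, v ϖ ^ m * v ϖ ^ n = v ϖ ^ (m + n) := fun m n => (zpow_add₀ hp0.ne' m n).symm
  have hs' : s = h := by
    rw [hB, det_val v τ hτ c _ hc, Matrix.det_fin_two_of] at hs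
    simp only [zero_mul, mul_one, zero_sub, Valuation.map_neg, map_zpow₀] at hs
    exact le_antisymm ((hle _ _).1 hs.le) ((hle _ _).1 hs.ge)
  refine ⟨hs', ?_⟩
  have hB2 := mat_two τ c !![0, ϖ ^ h; 1, 0] hc (by
    ext i j; fin_cases i <;> fin_cases j <;> simp [hϖ])
  rw [← hB] at hB2
  have hRR : !![0, ϖ ^ h; 1, 0] * !![0, ϖ ^ h; 1, 0] = Matrix.diagonal ![ϖ ^ h, ϖ ^ h] := by
    ext i j; fin_cases i <;> fin_cases j <;> simp
  rw [hRR] at hB2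
  obtain ⟨x, y, z, w, rfl⟩ : ∃ x y z w, c = !![x, y; z, w] :=
    ⟨_, _, _, _, Matrix.eta_fin_two c⟩
  have hD : x * w - y * z ≠ 0 := by
    have := hc.ne_zero
    rwa [Matrix.det_fin_two_of] at this
  rw [ent_odd] at hB
  rw [ent_diag] at hB2
  obtain ⟨d, hd⟩ := hgen _ hD
  have hτ2 : ∀ x, v ((τ.comp τ) x) = v x := fun x => by simp [hτ]
  have g1 := good_smul v (τ (x * w - y * z)) ((map_ne_zero _).2 hD) (y * τ w - ϖ ^ h * x * τ z)
     (ϖ ^ h * x * τ x - y * τ y) (w * τ w - ϖ ^ h * z * τ z) (ϖ ^ h * z * τ x - w * τ y) (v ϖ ^ m1)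
  have g2 : ∀ n, _ := fun n : ℤ => good_smul v ((τ.comp τ) (x * w - y * z)) ((map_ne_zero _).2 hD)
     (ϖ ^ h * x * (τ.comp τ) w - ϖ ^ h * y * (τ.comp τ) z)
     (ϖ ^ h * y * (τ.comp τ) x - ϖ ^ h * x * (τ.comp τ) y)
      (ϖ ^ h * z * (τ.comp τ) w - ϖ ^ h * w * (τ.comp τ) z)
      (ϖ ^ h * w * (τ.comp τ) x - ϖ ^ h * z * (τ.comp τ) y) (v ϖ ^ n)
  rw [← hB] at g1
  rw [← hB2] at g2
  simp only [hm1, hm2, hτ, hτ2, hd, hadd] at g1 g2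
  obtain ⟨-, q2, q3, -⟩ := g1.1 le_rfl
  rw [v.map_sub_swap] at q2
  have hQ : ∀ s t, s ≠ 0 → v s * v s ≠ v (ϖ ^ h) * v t * v t := by
    intro s t hs e
    obtain ⟨i, hi⟩ := hgen s hs
    have ht : t ≠ 0 := by
      rintro rfl
      rw [map_zero, mul_zero, mul_self_eq_zero] at e
      exact hs (v.zero_iff.1 e)
    obtain ⟨j, hj⟩ := hgen t ht
    rw [hi, hj, map_zpow₀, hadd, hadd, hadd] at e
    have := le_antisymm ((hle _ _).1 e.le) ((hle _ _).1 e.ge)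
    obtain ⟨k, hk⟩ := hodd
    omega
  obtain ⟨a1, a2⟩ := gen_odd_aux v τ hτ (ϖ ^ h) hQ y x _ q2
  obtain ⟨a3, a4⟩ := gen_odd_aux v τ hτ (ϖ ^ h) hQ w z _ q3
  -- `half` : exponent bound for products of one entry of each column
  obtain ⟨k, hk⟩ := hodd
  have half : ∀ s t u, (v s * v s ≤ v ϖ ^ (m1 + d)) → (v (ϖ ^ h) * v t * v t ≤ v ϖ ^ (m1 + d)) →
      v u = v s * v t → v (ϖ ^ h * u) ≤ v ϖ ^ (m1 + k + 1 + d) := by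
    intro s t u b1 b2 hu
    by_cases hs0 : s = 0
    · subst hs0; rw [map_mul, hu]; simp
    by_cases ht0 : t = 0
    · subst ht0; rw [map_mul, hu]; simp
    obtain ⟨i, hi⟩ := hgen s hs0
    obtain ⟨j, hj⟩ := hgen t ht0
    rw [map_mul, hu, hi, hj, map_zpow₀, hadd, hadd, hle]
    rw [hi, hadd, hle] at b1
    rw [hj, map_zpow₀, hadd, hadd, hle] at b2
    omega
  have := (g2 (m1 + k + 1)).2 (by
    simp only [mul_assoc]
    refine ⟨?_, ?_, ?_, ?_⟩ <;> refine v.map_sub_le ?_ ?_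
    · exact half w x _ a3 a2 (by rw [map_mul, hτ2, mul_comm])
    · exact half y z _ a1 a4 (by rw [map_mul, hτ2])
    · exact half y x _ a1 a2 (by rw [map_mul, hτ2])
    · exact half y x _ a1 a2 (by rw [map_mul, hτ2, mul_comm])
    · exact half w z _ a3 a4 (by rw [map_mul, hτ2, mul_comm])
    · exact half w z _ a3 a4 (by rw [map_mul, hτ2])
    · exact half w x _ a3 a2 (by rw [map_mul, hτ2])
    · exact half y z _ a1 a4 (by rw [map_mul, hτ2, mul_comm]))
  omega

theorem K_decomp (x : K) (hx : x ≠ 0) :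
    ∃ (n : ℤ) (u : 𝕎), IsUnit u ∧ x = (p : K) ^ n * algebraMap 𝕎 K u := by
  have hp0 : (p : K) ≠ 0 := by
    rw [← map_natCast (algebraMap 𝕎 K)]
    exact (map_ne_zero_iff _ (IsFractionRing.injective 𝕎 K)).2
      (WittVector.irreducible (p := p) (k := κ)).ne_zero
  obtain ⟨a, b, hb, rfl⟩ := IsFractionRing.div_surjective (A := 𝕎) x
  have hb0 : b ≠ 0 := nonZeroDivisors.ne_zero hb
  have ha0 : a ≠ 0 := by rintro rfl; simp at hx
  obtain ⟨m, s, rfl⟩ := WittVector.exists_eq_pow_p_mul' a ha0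
  obtain ⟨n, t, rfl⟩ := WittVector.exists_eq_pow_p_mul' b hb0
  refine ⟨(m : ℤ) - n, ((s * t⁻¹ : 𝕎ˣ) : 𝕎), Units.isUnit _, ?_⟩
  have ht : algebraMap 𝕎 K (t : 𝕎) * algebraMap 𝕎 K ((t⁻¹ : 𝕎ˣ) : 𝕎) = 1 := by
    rw [← map_mul, Units.mul_inv, map_one]
  have ht0 : algebraMap 𝕎 K (t : 𝕎) ≠ 0 := left_ne_zero_of_mul_eq_one ht
  rw [zpow_sub₀ hp0, div_eq_iff (by
    rw [map_mul, map_pow, map_natCast]; exact mul_ne_zero (pow_ne_zero _ hp0) ht0)]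
  simp only [map_mul, map_pow, map_natCast, zpow_natCast, Units.val_mul]
  have : (p : K) ^ n ≠ 0 := pow_ne_zero _ hp0
  field_simp
  linear_combination -ht

/-- the valuation on `K` -/
abbrev vK : Valuation K (ValuationRing.ValueGroup 𝕎 K) := ValuationRing.valuation 𝕎 K

theorem vK_le_one (x : K) : vK p κ x ≤ 1 ↔ ∃ a : 𝕎, algebraMap 𝕎 K a = x :=
  ValuationRing.mem_integer_iff 𝕎 K x

theorem vK_unit (u : 𝕎) (hu : IsUnit u) : vK p κ (algebraMap 𝕎 K u) = 1 := by
  obtain ⟨u, rfl⟩ := hu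
  have h1 : vK p κ (algebraMap 𝕎 K (u : 𝕎)) ≤ 1 := (vK_le_one p κ _).2 ⟨_, rfl⟩
  have h2 : vK p κ (algebraMap 𝕎 K ((u⁻¹ : 𝕎ˣ) : 𝕎)) ≤ 1 := (vK_le_one p κ _).2 ⟨_, rfl⟩
  have h3 : vK p κ (algebraMap 𝕎 K (u : 𝕎)) * vK p κ (algebraMap 𝕎 K ((u⁻¹ : 𝕎ˣ) : 𝕎)) = 1 := by
    rw [← map_mul, ← map_mul, Units.mul_inv, map_one, map_one]
  refine le_antisymm h1 ?_
  rw [← h3]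
  exact mul_le_of_le_one_right zero_le h2

theorem p_ne_zero : (p : K) ≠ 0 := by
  rw [← map_natCast (algebraMap 𝕎 K)]
  exact (map_ne_zero_iff _ (IsFractionRing.injective 𝕎 K)).2
      (WittVector.irreducible (p := p) (k := κ)).ne_zero

theorem vK_p_lt : vK p κ (p : K) < 1 := by
  have h1 : vK p κ (p : K) ≤ 1 := (vK_le_one p κ _).2 ⟨(p : 𝕎), by simp⟩
  refine lt_of_le_of_ne h1 fun h => ?_
  have h2 : vK p κ ((p : K)⁻¹) ≤ 1 := by rw [map_inv₀, h, inv_one]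
  obtain ⟨a, ha⟩ := (vK_le_one p κ _).1 h2
  refine (WittVector.irreducible (p := p) (k := κ)).not_isUnit
    (IsUnit.of_mul_eq_one a ?_)
  apply IsFractionRing.injective 𝕎 K
  rw [map_mul, ha, map_natCast, map_one, mul_inv_cancel₀ (p_ne_zero p κ)]

theorem vK_gen (x : K) (hx : x ≠ 0) : ∃ n : ℤ, vK p κ x = vK p κ (p : K) ^ n := by
  obtain ⟨n, u, hu, rfl⟩ := K_decomp p κ x hx
  exact ⟨n, by rw [map_mul, vK_unit p κ u hu, map_zpow₀, mul_one]⟩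

theorem vK_sigma (σ : K ≃+* K)
    (hσ : ∀ x : 𝕎, σ (algebraMap 𝕎 K x) = algebraMap 𝕎 K (WittVector.frobenius x)) (x : K) :
    vK p κ (σ x) = vK p κ x := by
  by_cases hx : x = 0
  · subst hx; simp
  obtain ⟨n, u, hu, rfl⟩ := K_decomp p κ x hx
  rw [map_mul, hσ, map_zpow₀, map_natCast, map_mul, map_mul, vK_unit p κ u hu,
    vK_unit p κ _ (hu.map WittVector.frobenius)]

theorem integral_entries {A : Matrix (Fin 2) (Fin 2) K} (h : IsIntegralUnit p κ A) :
    (∀ i j, vK p κ (A i j) ≤ 1) ∧ vK p κ A.det = 1 ∧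
      ∃ A' : Matrix (Fin 2) (Fin 2) K, (∀ i j, vK p κ (A' i j) ≤ 1) ∧ A' * A = 1 ∧ A * A' = 1 := by
  obtain ⟨d, hd, rfl⟩ := h
  refine ⟨fun i j => (vK_le_one p κ _).2 ⟨_, rfl⟩, ?_, (d⁻¹).map (algebraMap 𝕎 K),
    fun i j => (vK_le_one p κ _).2 ⟨_, rfl⟩, ?_, ?_⟩
  · rw [← RingHom.mapMatrix_apply, ← RingHom.map_det]; exact vK_unit p κ _ hd
  · rw [← Matrix.map_mul, Matrix.nonsing_inv_mul _ hd]; simp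
  · rw [← Matrix.map_mul, Matrix.mul_nonsing_inv _ hd]; simp

theorem good_mul_right {L Γ : Type*} [Field L] [LinearOrderedCommGroupWithZero Γ]
    (v : Valuation L Γ) (A B : Matrix (Fin 2) (Fin 2) L) (N : Γ) (hA : ∀ i j, v (A i j) ≤ N)
    (hB : ∀ i j, v (B i j) ≤ 1) : ∀ i j, v ((A * B) i j) ≤ N := by
  intro i j
  rw [Matrix.mul_apply]
  refine v.map_sum_le fun k _ => ?_
  rw [map_mul]
  exact (mul_le_of_le_one_right zero_le (hB _ _)).trans (hA _ _)

theorem good_mul_left {L Γ : Type*} [Field L] [LinearOrderedCommGroupWithZero Γ]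
    (v : Valuation L Γ) (A B : Matrix (Fin 2) (Fin 2) L) (N : Γ) (hA : ∀ i j, v (A i j) ≤ N)
    (hB : ∀ i j, v (B i j) ≤ 1) : ∀ i j, v ((B * A) i j) ≤ N := by
  intro i j
  rw [Matrix.mul_apply]
  refine v.map_sum_le fun k _ => ?_
  rw [map_mul, mul_comm]
  exact (mul_le_of_le_one_right zero_le (hB _ _)).trans (hA _ _)

theorem hodge_good {B : Matrix (Fin 2) (Fin 2) K} {μ : Fin 2 → ℤ} (h : IsHodgePoint p κ B μ) :
    (∀ n : ℤ, (∀ i j, vK p κ (B i j) ≤ vK p κ (p : K) ^ n) ↔ n ≤ μ 1) ∧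
      vK p κ B.det = vK p κ (p : K) ^ (μ 0 + μ 1) := by
  obtain ⟨hμ, c₁, c₂, h1, h2, rfl⟩ := h
  obtain ⟨a1, b1, d1, e1, f1, -⟩ := integral_entries p κ h1
  obtain ⟨a2, b2, d2, e2, -, f2⟩ := integral_entries p κ h2
  have hp0 : 0 < vK p κ (p : K) := zero_lt_iff.2 ((Valuation.ne_zero_iff _).2 (p_ne_zero p κ))
  have hle : ∀ m n : ℤ, vK p κ (p : K) ^ m ≤ vK p κ (p : K) ^ n ↔ n ≤ m :=
    fun m n => zpow_le_zpow_iff_right_of_lt_one₀ hp0 (vK_p_lt p κ)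
  have h01 : μ 1 ≤ μ 0 := hμ (by decide)
  constructor
  · intro n
    have hdiag : (∀ i j, vK p κ (Matrix.diagonal (fun i => (p : K) ^ (μ i)) i j) ≤
        vK p κ (p : K) ^ n) ↔ n ≤ μ 1 := by
      simp only [Fin.forall_fin_two, Matrix.diagonal_apply_eq, map_zpow₀, hle]
      constructor
      · rintro h; exact h.2.2
      · intro h
        refine ⟨⟨h.trans h01, ?_⟩, ?_, h⟩ <;> simp
    rw [← hdiag]
    constructor
    · intro h
      have := good_mul_left _ _ _ _ (good_mul_right _ _ _ _ h e2) e1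
      rw [Matrix.mul_assoc, f2, Matrix.mul_one, ← Matrix.mul_assoc, f1, Matrix.one_mul] at this
      exact this
    · intro h
      exact good_mul_right _ _ _ _ (good_mul_left _ _ _ _ h a1) a2
  · rw [Matrix.det_mul, Matrix.det_mul, Matrix.det_diagonal, map_mul, map_mul, b1, b2,
      Fin.prod_univ_two, map_mul, map_zpow₀, map_zpow₀, zpow_add₀ hp0.ne', one_mul, mul_one]

theorem integral_mul {A B : Matrix (Fin 2) (Fin 2) K} (hA : IsIntegralUnit p κ A)
    (hB : IsIntegralUnit p κ B) : IsIntegralUnit p κ (A * B) := by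
  obtain ⟨a, ha, rfl⟩ := hA
  obtain ⟨b, hb, rfl⟩ := hB
  exact ⟨a * b, by rw [Matrix.det_mul]; exact ha.mul hb, by rw [Matrix.map_mul]⟩

theorem integral_swap : IsIntegralUnit p κ !![0, 1; 1, 0] :=
  ⟨!![0, 1; 1, 0], by simp [Matrix.det_fin_two_of], by
    ext i j; fin_cases i <;> fin_cases j <;> simp⟩

theorem hodge_mul {A B C : Matrix (Fin 2) (Fin 2) K} (hA : IsIntegralUnit p κ A)
    (hC : IsIntegralUnit p κ C) {μ : Fin 2 → ℤ} (h : IsHodgePoint p κ B μ) :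
    IsHodgePoint p κ (A * B * C) μ := by
  obtain ⟨hμ, c₁, c₂, h1, h2, rfl⟩ := h
  exact ⟨hμ, A * c₁, c₂ * C, integral_mul p κ hA h1, integral_mul p κ h2 hC,
    by simp only [Matrix.mul_assoc]⟩

theorem hodge_pivot (x y z w : K) (hD : x * w - y * z ≠ 0) (h1 : vK p κ x ≤ vK p κ w)
    (h2 : vK p κ y ≤ vK p κ w) (h3 : vK p κ z ≤ vK p κ w) :
    ∃ μ, IsHodgePoint p κ !![x, y; z, w] μ := by
  have hw : w ≠ 0 := by
    rintro rfl
    rw [map_zero] at h2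
    have : y = 0 := (Valuation.zero_iff _).1 (le_antisymm h2 zero_le)
    exact hD (by simp [this])
  have hvw : 0 < vK p κ w := zero_lt_iff.2 ((Valuation.ne_zero_iff _).2 hw)
  have hp0 : 0 < vK p κ (p : K) := zero_lt_iff.2 ((Valuation.ne_zero_iff _).2 (p_ne_zero p κ))
  obtain ⟨y', hy⟩ := (vK_le_one p κ (y / w)).1 (by rw [map_div₀]; exact div_le_one_of_le₀ h2 zero_le)
  obtain ⟨z', hz⟩ := (vK_le_one p κ (z / w)).1 (by rw [map_div₀]; exact div_le_one_of_le₀ h3 zero_le)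
  have hq : x - y * (z / w) ≠ 0 := by
    intro h; apply hD; field_simp at h; linear_combination h
  have hvq : vK p κ (x - y * (z / w)) ≤ vK p κ w := by
    refine Valuation.map_sub_le _ h1 ?_
    rw [map_mul, ← hz]
    exact (mul_le_of_le_one_right zero_le ((vK_le_one p κ _).2 ⟨_, rfl⟩)).trans h2
  obtain ⟨m, s, hs, em⟩ := K_decomp p κ _ hq
  obtain ⟨n, t, ht, en⟩ := K_decomp p κ _ hw
  have hmn : n ≤ m := by
    rw [em, en, map_mul, map_mul, vK_unit p κ s hs, vK_unit p κ t ht, mul_one, mul_one, map_zpow₀,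
      map_zpow₀] at hvq
    exact (zpow_le_zpow_iff_right_of_lt_one₀ hp0 (vK_p_lt p κ)).1 hvq
  refine ⟨![m, n], ?_, (!![1, y'; 0, 1] : Matrix (Fin 2) (Fin 2) 𝕎).map (algebraMap 𝕎 K),
    (!![s, 0; t * z', t] : Matrix (Fin 2) (Fin 2) 𝕎).map (algebraMap 𝕎 K), ⟨_, ?_, rfl⟩, ⟨_, ?_, rfl⟩, ?_⟩
  · intro i j hij
    fin_cases i <;> fin_cases j <;> simp_all
  · simp [Matrix.det_fin_two_of]
  · simpa [Matrix.det_fin_two_of] using ⟨hs, ht⟩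
  · have e1 : x = (p : K) ^ m * algebraMap 𝕎 K s + algebraMap 𝕎 K y' * ((p : K) ^ n * (algebraMap 𝕎 K t * algebraMap 𝕎 K z')) := by
      rw [← mul_assoc (_ ^ n), ← em, ← en, hy, hz]; field_simp; ring
    have e2 : y = algebraMap 𝕎 K y' * ((p : K) ^ n * algebraMap 𝕎 K t) := by
      rw [← en, hy]; field_simp
    have e3 : z = (p : K) ^ n * (algebraMap 𝕎 K t * algebraMap 𝕎 K z') := by
      rw [← mul_assoc (_ ^ n), ← en, hz]; field_simp
    have hdg : Matrix.diagonal (fun i => (p : K) ^ (![m, n] i)) = !![(p : K) ^ m, 0; 0, (p : K) ^ n] := by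
      ext i j; fin_cases i <;> fin_cases j <;> simp
    have f1 : (!![1, y'; 0, 1] : Matrix (Fin 2) (Fin 2) 𝕎).map (algebraMap 𝕎 K) =
      !![1, algebraMap 𝕎 K y'; 0, 1] := by
      ext i j; fin_cases i <;> fin_cases j <;> simp
    have f2 : (!![s, 0; t * z', t] : Matrix (Fin 2) (Fin 2) 𝕎).map (algebraMap 𝕎 K) =
      !![algebraMap 𝕎 K s, 0; algebraMap 𝕎 K t * algebraMap 𝕎 K z', algebraMap 𝕎 K t] := by
      ext i j; fin_cases i <;> fin_cases j <;> simp
    rw [hdg, f1, f2, Matrix.mul_fin_two, Matrix.mul_fin_two]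
    congr! 3
    · rw [e1]; ring
    · congr! 1
      rw [e2]; ring
    · congr! 2
      · rw [e3]; ring
      · rw [en]; ring

theorem hodge_exists (B : Matrix (Fin 2) (Fin 2) K) (hB : IsUnit B.det) :
    ∃ μ, IsHodgePoint p κ B μ := by
  obtain ⟨x, y, z, w, rfl⟩ : ∃ x y z w, B = !![x, y; z, w] :=
    ⟨_, _, _, _, Matrix.eta_fin_two B⟩
  have hD : x * w - y * z ≠ 0 := by
    have := hB.ne_zero
    rwa [Matrix.det_fin_two_of] at this
  -- it suffices to treat matrices whose second row contains a maximal entry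
  have row : ∀ x y z w : K, x * w - y * z ≠ 0 →
      max (vK p κ x) (vK p κ y) ≤ max (vK p κ z) (vK p κ w) →
      ∃ μ, IsHodgePoint p κ !![x, y; z, w] μ := by
    intro x y z w hD h
    rcases le_total (vK p κ z) (vK p κ w) with h' | h'
    · rw [max_eq_right h', max_le_iff] at h
      exact hodge_pivot p κ x y z w hD h.1 h.2 h'
    · rw [max_eq_left h', max_le_iff] at h
      obtain ⟨μ, hμ⟩ := hodge_pivot p κ y x w z (by
        intro e; apply hD; linear_combination -e) h.2 h.1 h'
      refine ⟨μ, ?_⟩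
      have := hodge_mul p κ (A := 1) ⟨1, by simp, by simp⟩ (integral_swap p κ) hμ
      simpa [Matrix.mul_fin_two] using this
  rcases le_total (max (vK p κ x) (vK p κ y)) (max (vK p κ z) (vK p κ w)) with h | h
  · exact row x y z w hD h
  · obtain ⟨μ, hμ⟩ := row z w x y (by intro e; apply hD; linear_combination -e) h
    refine ⟨μ, ?_⟩
    have := hodge_mul p κ (integral_swap p κ) (C := 1) ⟨1, by simp, by simp⟩ hμ
    simpa [Matrix.mul_fin_two] using this

theorem starPow_add {g : ℕ} (σ : K ≃+* K) (b : ZMod g → Matrix (Fin 2) (Fin 2) K) (m k : ℕ)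
    (i : ZMod g) : starPow p κ σ b (m + k) i =
      starPow p κ σ b m i * (starPow p κ σ b k (i - m)).map ((⇑σ)^[m]) := by
  induction m generalizing i with
  | zero => simp [starPow]
  | succ m ih =>
    rw [show m + 1 + k = (m + k) + 1 by ring]
    simp only [starPow]
    rw [ih, Matrix.map_mul, Matrix.map_map, Matrix.mul_assoc, Function.iterate_succ',
      show i - 1 - (m : ZMod g) = i - ((m + 1 : ℕ) : ZMod g) by push_cast; ring]

theorem starPow_det {g : ℕ} (σ : K ≃+* K) (b : ZMod g → Matrix (Fin 2) (Fin 2) K)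
    (hb : ∀ j, IsUnit (b j).det) (k : ℕ) (i : ZMod g) : IsUnit (starPow p κ σ b k i).det := by
  induction k generalizing i with
  | zero => simp [starPow]
  | succ k ih =>
    simp only [starPow]
    rw [Matrix.det_mul]
    refine (hb i).mul ?_
    have := (ih (i - 1)).map (σ : K →+* K)
    rwa [RingHom.map_det] at this

theorem slopes_of_normal (g : ℕ) (σ : K ≃+* K)
    (hσ : ∀ x : 𝕎, σ (algebraMap 𝕎 K x) = algebraMap 𝕎 K (WittVector.frobenius x))
    (b : ZMod g → Matrix (Fin 2) (Fin 2) K) (μ ν : Fin 2 → ℤ)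
    (hμ : IsHodgePoint p κ (starPow p κ σ b g 0) μ)
    (hν : IsHodgePoint p κ (starPow p κ σ b (2 * g) 0) ν)
    (c R : Matrix (Fin 2) (Fin 2) K) (hc : IsUnit c.det) (slo : Multiset ℚ)
    (hR : IsNormalFormWithSlopes p κ R slo)
    (hB : starPow p κ σ b g 0 = c * R * (c.map ((⇑σ)^[g]))⁻¹) :
    slo = {((min (2 * (ν 1 - μ 1)) (μ 0 + μ 1) : ℤ) : ℚ) / 2,
      ((μ 0 + μ 1 : ℤ) : ℚ) - ((min (2 * (ν 1 - μ 1)) (μ 0 + μ 1) : ℤ) : ℚ) / 2} := by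
  let τ : K →+* K := (σ : K →+* K) ^ g
  have hτc : ⇑τ = (⇑σ)^[g] := by simp [τ, RingHom.coe_pow]
  have hτ : ∀ x, vK p κ (τ x) = vK p κ x := by
    intro x
    rw [hτc]
    generalize g = k
    induction k with
    | zero => rfl
    | succ k ih => rw [Function.iterate_succ_apply', vK_sigma p κ σ hσ, ih]
  have h2 : starPow p κ σ b (2 * g) 0 = starPow p κ σ b g 0 * (starPow p κ σ b g 0).map τ := by
    rw [two_mul, starPow_add, hτc]; simp
  obtain ⟨hm1, hs⟩ := hodge_good p κ hμ
  obtain ⟨hm2, -⟩ := hodge_good p κ hν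
  rw [h2] at hm2
  rw [← hτc] at hB
  rcases hR with ⟨a, d, had, rfl, rfl⟩ | ⟨h, hodd, rfl, rfl⟩
  · obtain ⟨e1, e2⟩ := slopes_diag (vK p κ) τ hτ (p : K) (map_natCast τ p) (p_ne_zero p κ)
      (vK_p_lt p κ) (vK_gen p κ) c hc a d had _ _ _ _ hB hm1 hm2 hs
    rw [← e2, e1]
    push_cast
    congr! 1
    · ring
    · congr! 1; ring
  · obtain ⟨e1, e2⟩ := slopes_odd (vK p κ) τ hτ (p : K) (map_natCast τ p) (p_ne_zero p κ)
      (vK_p_lt p κ) (vK_gen p κ) c hc h hodd _ _ _ _ hB hm1 hm2 hs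
    rw [← e2, e1]
    congr! 2
    ring

theorem statement_14 (g : ℕ) (hg : 1 ≤ g) (σ : K ≃+* K)
    (hσ : ∀ x : 𝕎, σ (algebraMap 𝕎 K x) = algebraMap 𝕎 K (WittVector.frobenius x))
    (b b' : ZMod g → Matrix (Fin 2) (Fin 2) K)
    (hb : ∀ j, IsUnit (b j).det) (hb' : ∀ j, IsUnit (b' j).det)
    (hH : ∀ i, 1 ≤ i → i ≤ 2 * g → ∀ j : ZMod g, ∀ μ : Fin 2 → ℤ,
      IsHodgePoint p κ (starPow p κ σ b i j) μ ↔ IsHodgePoint p κ (starPow p κ σ b' i j) μ)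
    (c c' R R' : Matrix (Fin 2) (Fin 2) K)
    (hc : IsUnit c.det) (hc' : IsUnit c'.det)
    (slo slo' : Multiset ℚ)
    (hR : IsNormalFormWithSlopes p κ R slo) (hR' : IsNormalFormWithSlopes p κ R' slo')
    (hB : starPow p κ σ b g 0 = c * R * (c.map ((⇑σ)^[g]))⁻¹)
    (hB' : starPow p κ σ b' g 0 = c' * R' * (c'.map ((⇑σ)^[g]))⁻¹) :
    slo = slo' := by
  have hg2 : g ≤ 2 * g := by omega
  obtain ⟨μ, hμ⟩ := hodge_exists p κ _ (starPow_det p κ σ b hb g 0)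
  obtain ⟨ν, hν⟩ := hodge_exists p κ _ (starPow_det p κ σ b hb (2 * g) 0)
  rw [slopes_of_normal p κ g σ hσ b μ ν hμ hν c R hc slo hR hB,
    slopes_of_normal p κ g σ hσ b' μ ν ((hH g hg hg2 0 μ).1 hμ)
      ((hH (2 * g) (by omega) le_rfl 0 ν).1 hν) c' R' hc' slo' hR' hB']

end
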